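/- Perturbation bound for discounted state distributions. For a finite MDP with discount γ ∈ (0,1) and two policies π and π̃, the discounted state distributions satisfy ‖d_π − d_{π̃}‖₁ ≤ (γ/(1−γ)) · ‖(P_π − P_{π̃}) d_π‖₁, where (P_π − P_{π̃}) d_π denotes the vector with entries ∑_s (P_π(s'|s) − P_{π̃}(s'|s)) d_π(s). -/

import Mathlib

open scoped BigOperators

noncomputable section

/-- Policy-induced state transition matrix. -/
def Pmat {S A : Type*} [Fintype A] (P : S → A → S → ℝ) (π : S → A → ℝ) :
    Matrix S S ℝ := fun s' s => ∑ a, P s a s' * π s a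

/-- Discounted state distribution. -/
def dpi {S A : Type*} [Fintype S] [DecidableEq S] [Fintype A]
    (P : S → A → S → ℝ) (d0 : S → ℝ) (γ : ℝ) (π : S → A → ℝ) (s : S) : ℝ :=
  (1 - γ) * ∑' t : ℕ, γ ^ t * ((Pmat P π ^ t).mulVec d0 s)

lemma Pmat_nonneg {S A : Type*} [Fintype A] (P : S → A → S → ℝ)
    (hPnn : ∀ s a s', 0 ≤ P s a s') (π : S → A → ℝ) (hπnn : ∀ s a, 0 ≤ π s a) (s' s : S) :
    0 ≤ Pmat P π s' s :=
  Finset.sum_nonneg fun a _ => mul_nonneg (hPnn s a s') (hπnn s a)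

lemma Pmat_sum {S A : Type*} [Fintype S] [Fintype A] (P : S → A → S → ℝ)
    (hPsum : ∀ s a, ∑ s', P s a s' = 1) (π : S → A → ℝ) (hπsum : ∀ s, ∑ a, π s a = 1) (s : S) :
    ∑ s', Pmat P π s' s = 1 := by
  unfold Pmat
  rw [Finset.sum_comm]
  simp_rw [← Finset.sum_mul, hPsum, one_mul, hπsum]

lemma dpi_fix {S A : Type*} [Fintype S] [DecidableEq S] [Fintype A]
    (P : S → A → S → ℝ) (hPnn : ∀ s a s', 0 ≤ P s a s')
    (hPsum : ∀ s a, ∑ s', P s a s' = 1)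
    (d0 : S → ℝ) (hd0nn : ∀ s, 0 ≤ d0 s) (hd0sum : ∑ s, d0 s = 1)
    (γ : ℝ) (hγ0 : 0 < γ) (hγ1 : γ < 1)
    (π : S → A → ℝ) (hπnn : ∀ s a, 0 ≤ π s a) (hπsum : ∀ s, ∑ a, π s a = 1) (s' : S) :
    dpi P d0 γ π s' = (1 - γ) * d0 s' + γ * ∑ s, Pmat P π s' s * dpi P d0 γ π s := by
  have step : ∀ t s', (Pmat P π ^ (t + 1)).mulVec d0 s'
      = ∑ s, Pmat P π s' s * (Pmat P π ^ t).mulVec d0 s := by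
    intro t s'
    rw [pow_succ', ← Matrix.mulVec_mulVec]
    rfl
  have key : ∀ t : ℕ, (∀ s, 0 ≤ (Pmat P π ^ t).mulVec d0 s) ∧
      ∑ s, (Pmat P π ^ t).mulVec d0 s = 1 := by
    intro t
    induction t with
    | zero => simpa using ⟨hd0nn, hd0sum⟩
    | succ t ih =>
      simp_rw [step]
      refine ⟨fun s => Finset.sum_nonneg fun x _ =>
        mul_nonneg (Pmat_nonneg P hPnn π hπnn _ _) (ih.1 x), ?_⟩
      rw [Finset.sum_comm]
      simp_rw [← Finset.sum_mul, Pmat_sum P hPsum π hπsum, one_mul]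
      exact ih.2
  have hs : ∀ s, Summable fun t : ℕ => γ ^ t * ((Pmat P π ^ t).mulVec d0 s) := by
    intro s
    refine Summable.of_nonneg_of_le (fun t => mul_nonneg (by positivity) ((key t).1 s))
      (fun t => ?_) (summable_geometric_of_lt_one hγ0.le hγ1)
    refine mul_le_of_le_one_right (by positivity) ?_
    rw [← (key t).2]
    exact Finset.single_le_sum (fun x _ => (key t).1 x) (Finset.mem_univ s)
  have h1 : ∑' t : ℕ, γ ^ (t + 1) * ((Pmat P π ^ (t + 1)).mulVec d0 s')
      = γ * ∑ s, Pmat P π s' s * ∑' t : ℕ, γ ^ t * ((Pmat P π ^ t).mulVec d0 s) := by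
    simp_rw [← tsum_mul_left]
    rw [← Summable.tsum_finsetSum (fun s _ => (hs s).mul_left _), ← tsum_mul_left]
    refine tsum_congr fun t => ?_
    rw [step, Finset.mul_sum, Finset.mul_sum]
    refine Finset.sum_congr rfl fun s _ => ?_
    ring
  unfold dpi
  rw [(hs s').tsum_eq_zero_add, h1]
  simp only [pow_zero, Matrix.one_mulVec, one_mul, mul_add, Finset.mul_sum]
  congr 1
  refine Finset.sum_congr rfl fun s _ => ?_
  ring

/-- Perturbation bound for discounted state distributions:
`‖d_π − d_π̃‖₁ ≤ (γ/(1−γ)) ‖(P_π − P_π̃) d_π‖₁`. -/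
theorem perturbation_bound_discounted_distribution
    {S A : Type*} [Fintype S] [DecidableEq S] [Fintype A]
    (P : S → A → S → ℝ) (hPnn : ∀ s a s', 0 ≤ P s a s')
    (hPsum : ∀ s a, ∑ s', P s a s' = 1)
    (d0 : S → ℝ) (hd0nn : ∀ s, 0 ≤ d0 s) (hd0sum : ∑ s, d0 s = 1)
    (γ : ℝ) (hγ0 : 0 < γ) (hγ1 : γ < 1)
    (π πt : S → A → ℝ)
    (hπnn : ∀ s a, 0 ≤ π s a) (hπsum : ∀ s, ∑ a, π s a = 1)
    (hπtnn : ∀ s a, 0 ≤ πt s a) (hπtsum : ∀ s, ∑ a, πt s a = 1) :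
    ∑ s, |dpi P d0 γ π s - dpi P d0 γ πt s|
      ≤ (γ / (1 - γ)) *
          ∑ s', |∑ s, (Pmat P π s' s - Pmat P πt s' s) * dpi P d0 γ π s| := by
  have hb : 0 < 1 - γ := by linarith
  have f1 := dpi_fix P hPnn hPsum d0 hd0nn hd0sum γ hγ0 hγ1 π hπnn hπsum
  have f2 := dpi_fix P hPnn hPsum d0 hd0nn hd0sum γ hγ0 hγ1 πt hπtnn hπtsum
  generalize dpi P d0 γ π = d at *
  generalize dpi P d0 γ πt = e at *
  have hpt : ∀ s', |d s' - e s'| ≤ γ * |∑ s, (Pmat P π s' s - Pmat P πt s' s) * d s|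
      + γ * ∑ s, Pmat P πt s' s * |d s - e s| := by
    intro s'
    have h : d s' - e s' = γ * (∑ s, (Pmat P π s' s - Pmat P πt s' s) * d s)
        + γ * ∑ s, Pmat P πt s' s * (d s - e s) := by
      rw [f1 s', f2 s']
      simp only [sub_mul, mul_sub, Finset.sum_sub_distrib]
      ring
    rw [h]
    refine (abs_add_le _ _).trans ?_
    rw [abs_mul, abs_mul, abs_of_pos hγ0]
    gcongr
    refine (Finset.abs_sum_le_sum_abs _ _).trans (Finset.sum_le_sum fun s _ => ?_)
    rw [abs_mul, abs_of_nonneg (Pmat_nonneg P hPnn πt hπtnn _ _)]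
  have hsum := Finset.sum_le_sum fun s' (_ : s' ∈ Finset.univ) => hpt s'
  rw [Finset.sum_add_distrib, ← Finset.mul_sum, ← Finset.mul_sum,
    Finset.sum_comm (f := fun s' s => Pmat P πt s' s * |d s - e s|)] at hsum
  simp_rw [← Finset.sum_mul, Pmat_sum P hPsum πt hπtsum, one_mul] at hsum
  rw [div_mul_eq_mul_div, le_div_iff₀ hb]
  linarith
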